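/- Define the elementary Schur polynomials S_k ∈ ℂ[x₁, x₂, x₃, …] (k ∈ ℤ) by the generating function Σ_{k≥0} S_k(x) z^k = exp(Σ_{j≥1} x_j z^j), with S_k = 0 for k < 0. For a partition λ = (λ₁ ≥ λ₂ ≥ … ≥ λ_ℓ ≥ 0) of integers, define the Schur polynomial S_λ = det( S_{λ_i − i + j} )_{1≤i,j≤ℓ}. Fix real constants c₄, c₅, c₆, … (only finitely many of which occur in S_λ), and define τ : ℝ³ → ℝ by τ(x, y, t) = S_λ(x, y, t, c₄, c₅, …), i.e., S_λ evaluated at x₁ = x, x₂ = y, x₃ = t, x_j = c_j for j ≥ 4. Then the function u(x, y, t) = 2 ∂²/∂x² ( log τ(x, y, t) ) satisfies the Kadomtsev–Petviashvili equation (3/4) ∂²u/∂y² = ∂/∂x ( ∂u/∂t − (3/2) u ∂u/∂x − (1/4) ∂³u/∂x³ ) at every point (x, y, t) where τ(x, y, t) ≠ 0. -/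

import Mathlib

open MvPolynomial

/-- The elementary Schur polynomials `S_k ∈ ℝ[x₁, x₂, …]`, defined by the generating function
`Σ_{k≥0} S_k z^k = exp(Σ_{j≥1} x_j z^j)`; equivalently, `S_0 = 1` and
`(k+1) S_{k+1} = Σ_{j=1}^{k+1} j x_j S_{k+1−j}` (the coefficientwise form of the generating
function identity obtained by differentiating in `z`).  Variables are indexed by `ℕ`, the
variable `x_0` being unused. -/
noncomputable def elemSchur : ℕ → MvPolynomial ℕ ℝ
  | 0 => 1
  | (k + 1) =>
      ((k + 1 : ℝ))⁻¹ •
        ∑ j ∈ Finset.range (k + 1), ((j + 1 : ℕ) : ℝ) • (X (j + 1) * elemSchur (k - j))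
  termination_by k => k
  decreasing_by omega

/-- `S_k` extended to integer indices by `S_k = 0` for `k < 0`. -/
noncomputable def elemSchurZ (k : ℤ) : MvPolynomial ℕ ℝ :=
  if 0 ≤ k then elemSchur k.toNat else 0

/-- The Schur polynomial of a partition `λ₁ ≥ λ₂ ≥ … ≥ λ_ℓ ≥ 0`, given by the Jacobi–Trudi
determinant `S_λ = det(S_{λ_i − i + j})_{1≤i,j≤ℓ}` (here with `0`-based indices). -/
noncomputable def schurOfPartition (ℓ : ℕ) (lam : Fin ℓ → ℕ) : MvPolynomial ℕ ℝ :=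
  (Matrix.of fun i j : Fin ℓ => elemSchurZ ((lam i : ℤ) - (i : ℤ) + (j : ℤ))).det

/-- The `n`-th KP flow on polynomials in the affine coordinates `w_{k,m}` of the Sato
Grassmannian: `∂_n w_{k,m} = w_{k+n,m} - w_{k,m+n} - Σ_{p<n} w_{n-p,m} w_{k,p}`. -/
noncomputable def riccati (n : ℕ) :
    Derivation ℝ (MvPolynomial (ℕ × ℕ) ℝ) (MvPolynomial (ℕ × ℕ) ℝ) :=
  mkDerivation ℝ fun q => X (q.1 + n, q.2) - X (q.1, q.2 + n)
    - ∑ p ∈ Finset.range n, X (n - p, q.2) * X (q.1, p)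

theorem riccati_X (n k m : ℕ) : riccati n (X (k, m)) = X (k + n, m) - X (k, m + n)
    - ∑ p ∈ Finset.range n, X (n - p, m) * X (k, p) :=
  mkDerivation_X _ _ _

theorem riccati_comm_two (P : MvPolynomial (ℕ × ℕ) ℝ) :
    riccati 1 (riccati 2 P) = riccati 2 (riccati 1 P) := by
  have h : ⁅riccati 1, riccati 2⁆ = 0 := by
    refine derivation_ext fun ⟨k, m⟩ => ?_
    simp [Derivation.commutator_apply, riccati_X, Finset.sum_range_succ, Derivation.leibniz,
      add_assoc]
    ring
  have := congrArg (fun d => d P) h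
  simpa [Derivation.commutator_apply, sub_eq_zero] using this

theorem riccati_comm_three (P : MvPolynomial (ℕ × ℕ) ℝ) :
    riccati 1 (riccati 3 P) = riccati 3 (riccati 1 P) := by
  have h : ⁅riccati 1, riccati 3⁆ = 0 := by
    refine derivation_ext fun ⟨k, m⟩ => ?_
    simp [Derivation.commutator_apply, riccati_X, Finset.sum_range_succ, Derivation.leibniz,
      add_assoc]
    ring
  have := congrArg (fun d => d P) h
  simpa [Derivation.commutator_apply, sub_eq_zero] using this

theorem riccati_two_X_one_zero :
    riccati 2 (X (1, 0)) = riccati 1 (X (2, 0) + X (1, 1)) := by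
  simp [riccati_X, Finset.sum_range_succ]
  ring

/-- The KP equation in bilinear form, divided by `2 τ²`; here `w_{1,0} = ∂_1 log τ` and
`w_{2,0} + w_{1,1} = ∂_2 log τ`. -/
theorem riccati_bilinear :
    riccati 1 (riccati 1 (riccati 1 (X (1, 0)))) + 6 * riccati 1 (X (1, 0)) ^ 2
      - 4 * riccati 3 (X (1, 0)) + 3 * riccati 2 (X (2, 0) + X (1, 1)) = 0 := by
  simp [riccati_X, Finset.sum_range_succ, Derivation.leibniz]
  ring

theorem elemSchurZ_zero : elemSchurZ 0 = 1 := by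
  simp [elemSchurZ, elemSchur]

theorem elemSchurZ_of_neg {k : ℤ} (hk : k < 0) : elemSchurZ k = 0 := by
  simp [elemSchurZ, hk]

theorem elemSchurZ_recursion (k : ℤ) (N : ℕ) (hN : k ≤ N) :
    (k : ℝ) • elemSchurZ k =
      ∑ j ∈ Finset.range N, ((j + 1 : ℕ) : ℝ) • (X (j + 1) * elemSchurZ (k - (j + 1 : ℕ))) := by
  rcases le_or_gt k 0 with hk | hk
  · rw [Finset.sum_eq_zero fun j _ => by
      rw [elemSchurZ_of_neg (show k - (j + 1 : ℕ) < 0 by omega), mul_zero, smul_zero]]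
    rcases hk.lt_or_eq with hk | rfl
    · rw [elemSchurZ_of_neg hk, smul_zero]
    · simp
  · obtain ⟨n, rfl⟩ : ∃ n : ℕ, k = (n + 1 : ℕ) := ⟨(k - 1).toNat, by omega⟩
    have hle : n + 1 ≤ N := by exact_mod_cast hN
    rw [← Finset.sum_subset (Finset.range_mono hle) fun j _ hj => by
      rw [Finset.mem_range, not_lt] at hj
      rw [elemSchurZ_of_neg (by omega), mul_zero, smul_zero]]
    have hZ : elemSchurZ ((n + 1 : ℕ) : ℤ) = elemSchur (n + 1) := by
      rw [elemSchurZ, if_pos (by omega), Int.toNat_natCast]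
    rw [hZ, elemSchur, smul_smul]
    have hn : (((n + 1 : ℕ) : ℤ) : ℝ) * ((n + 1 : ℝ))⁻¹ = 1 := by
      push_cast
      exact mul_inv_cancel₀ (by positivity)
    rw [hn, one_smul]
    refine Finset.sum_congr rfl fun j hj => ?_
    rw [Finset.mem_range] at hj
    rw [elemSchurZ, if_pos (by omega)]
    congr 4
    omega

/-- Differentiating the generating function in `x_n` multiplies it by `z ^ n`. -/
theorem pderiv_elemSchurZ (n : ℕ) (hn : 0 < n) (k : ℤ) :
    pderiv n (elemSchurZ k) = elemSchurZ (k - n) := by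
  rcases lt_or_ge k 0 with hk | hk
  · rw [elemSchurZ_of_neg hk, elemSchurZ_of_neg (by omega), map_zero]
  obtain ⟨N, rfl⟩ := Int.eq_ofNat_of_zero_le hk
  induction N using Nat.strong_induction_on with
  | _ N ih =>
    rcases Nat.eq_zero_or_pos N with rfl | hN
    · rw [Nat.cast_zero, elemSchurZ_zero, elemSchurZ_of_neg (by omega)]
      simp
    have hN0 : ((N : ℤ) : ℝ) ≠ 0 := by
      exact_mod_cast hN.ne'
    apply smul_right_injective _ hN0
    have key : ∀ j ∈ Finset.range (N + n),
        pderiv n (((j + 1 : ℕ) : ℝ) • (X (j + 1) * elemSchurZ ((N : ℤ) - (j + 1 : ℕ)))) =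
          (((j + 1 : ℕ) : ℝ) • (X (j + 1) * elemSchurZ ((N : ℤ) - n - (j + 1 : ℕ)))) +
          if j = n - 1 then (n : ℝ) • elemSchurZ ((N : ℤ) - n) else 0 := by
      intro j _
      have hd : pderiv n (elemSchurZ ((N : ℤ) - (j + 1 : ℕ))) =
          elemSchurZ ((N : ℤ) - n - (j + 1 : ℕ)) := by
        rcases lt_or_ge ((N : ℤ) - (j + 1 : ℕ)) 0 with h | h
        · rw [elemSchurZ_of_neg h, elemSchurZ_of_neg (by omega), map_zero]
        · have := ih (N - (j + 1)) (by omega) (by omega)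
          rw [Nat.cast_sub (by omega)] at this
          rw [this]
          congr 1
          ring
      rw [Derivation.map_smul, Derivation.leibniz, hd, smul_add, smul_eq_mul, smul_eq_mul]
      congr 1
      split_ifs with h
      · have hj : j + 1 = n := by omega
        rw [hj, pderiv_X_self, mul_one]
      · rw [pderiv_X_of_ne (by omega), mul_zero, smul_zero]
    change ((N : ℤ) : ℝ) • pderiv n (elemSchurZ N) = ((N : ℤ) : ℝ) • elemSchurZ ((N : ℤ) - n)
    rw [← Derivation.map_smul, elemSchurZ_recursion N (N + n) (by push_cast; omega), map_sum,
      Finset.sum_congr rfl key, Finset.sum_add_distrib,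
      ← elemSchurZ_recursion ((N : ℤ) - n) (N + n) (by push_cast; omega),
      Finset.sum_ite_eq', if_pos (Finset.mem_range.2 (by omega)), ← add_smul]
    congr 1
    push_cast
    ring

theorem Derivation.map_prod_eq_sum_update {R A ι : Type*} [CommRing R] [CommRing A] [Algebra R A]
    [DecidableEq ι] (D : Derivation R A A) (s : Finset ι) (f : ι → A) :
    D (∏ i ∈ s, f i) = ∑ j ∈ s, ∏ i ∈ s, Function.update f j (D (f j)) i := by
  induction s using Finset.induction_on with
  | empty => simp
  | insert a s ha ih =>
    rw [Finset.prod_insert ha, D.leibniz, ih, Finset.sum_insert ha, Finset.prod_insert ha,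
      Function.update_self, smul_eq_mul, smul_eq_mul, Finset.mul_sum, add_comm]
    congr 1
    · rw [mul_comm]
      congr 1
      exact Finset.prod_congr rfl fun i hi =>
        (Function.update_of_ne (ne_of_mem_of_not_mem hi ha) _ _).symm
    · refine Finset.sum_congr rfl fun j hj => ?_
      rw [Finset.prod_insert ha, Function.update_of_ne (ne_of_mem_of_not_mem hj ha).symm]

theorem Derivation.map_det {R A ι : Type*} [CommRing R] [CommRing A] [Algebra R A]
    [DecidableEq ι] [Fintype ι] (D : Derivation R A A) (M : Matrix ι ι A) :
    D M.det = ∑ j, (M.updateCol j fun i => D (M i j)).det := by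
  simp_rw [Matrix.det_apply]
  rw [map_sum, Finset.sum_comm]
  refine Finset.sum_congr rfl fun σ _ => ?_
  rw [← Finset.smul_sum, Units.smul_def, Units.smul_def, map_zsmul, D.map_prod_eq_sum_update]
  congr 1
  refine Finset.sum_congr rfl fun j _ => Finset.prod_congr rfl fun i _ => ?_
  by_cases h : i = j
  · subst h
    simp
  · simp [h]

theorem MvPolynomial.hasDerivAt_eval_update {σ : Type*} [DecidableEq σ] (p : MvPolynomial σ ℝ)
    (v : σ → ℝ) (n : σ) (x : ℝ) :
    HasDerivAt (fun s => eval (Function.update v n s) p)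
      (eval (Function.update v n x) (pderiv n p)) x := by
  induction p using MvPolynomial.induction_on with
  | C a => simpa using hasDerivAt_const x a
  | add p q hp hq => simpa using hp.fun_add hq
  | mul_X p i hp =>
    have hX : HasDerivAt (fun s => Function.update v n s i)
        (eval (Function.update v n x) (pderiv n (X i))) x := by
      by_cases h : i = n
      · subst h
        simpa using hasDerivAt_id' x
      · simpa [h, pderiv_X_of_ne h] using hasDerivAt_const x (v i)
    simp only [map_mul, eval_X]
    refine (hp.fun_mul hX).congr_deriv ?_
    simp [Derivation.leibniz]
    ring

/-- The Jacobi–Trudi matrix `S_{a_i + j}` with arbitrary integer row shifts `a_i`. -/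
noncomputable def jacobiTrudi {ℓ : ℕ} (a : Fin ℓ → ℤ) :
    Matrix (Fin ℓ) (Fin ℓ) (MvPolynomial ℕ ℝ) :=
  Matrix.of fun i j => elemSchurZ (a i + (j : ℤ))

/-- The coordinate `(k, m)` is the `m`-th entry of the solution `w` of `A w = (S_{a_i - k})_i`,
where `A` is the Jacobi–Trudi matrix evaluated at `v`; it is zero for `m` out of range. -/
noncomputable def affineCoord {ℓ : ℕ} (a : Fin ℓ → ℤ) (v : ℕ → ℝ) (q : ℕ × ℕ) : ℝ :=
  if h : q.2 < ℓ then
    eval v (Matrix.cramer (jacobiTrudi a) (fun i => elemSchurZ (a i - (q.1 : ℤ))) ⟨q.2, h⟩) /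
      eval v (jacobiTrudi a).det
  else 0

section affineCoord

variable {ℓ : ℕ} (a : Fin ℓ → ℤ)

theorem affineCoord_of_le (v : ℕ → ℝ) (k : ℕ) {m : ℕ} (hm : ℓ ≤ m) :
    affineCoord a v (k, m) = 0 :=
  dif_neg hm.not_gt

theorem sum_mul_affineCoord {v : ℕ → ℝ} (hv : eval v (jacobiTrudi a).det ≠ 0) (k : ℕ)
    (i : Fin ℓ) :
    ∑ j ∈ Finset.range ℓ, eval v (elemSchurZ (a i + (j : ℤ))) * affineCoord a v (k, j) =
      eval v (elemSchurZ (a i - (k : ℤ))) := by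
  rw [Finset.sum_range]
  have h := congrArg (eval v) (congrFun (Matrix.mulVec_cramer (jacobiTrudi a)
    (fun i => elemSchurZ (a i - (k : ℤ)))) i)
  simp only [Matrix.mulVec, dotProduct, map_sum, map_mul, Pi.smul_apply, smul_eq_mul] at h
  rw [← mul_right_inj' hv, ← h, Finset.mul_sum]
  refine Finset.sum_congr rfl fun j _ => ?_
  rw [affineCoord, dif_pos j.2, mul_left_comm, mul_div_cancel₀ _ hv]
  rfl

theorem eq_zero_of_sum_mul_eq_zero {v : ℕ → ℝ} (hv : eval v (jacobiTrudi a).det ≠ 0) {f : ℕ → ℝ}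
    (hf : ∀ i, ∑ j ∈ Finset.range ℓ, eval v (elemSchurZ (a i + (j : ℤ))) * f j = 0) {m : ℕ}
    (hm : m < ℓ) : f m = 0 := by
  have h : ((eval v).mapMatrix (jacobiTrudi a)).mulVec (fun j : Fin ℓ => f j) = 0 := by
    ext i
    rw [Pi.zero_apply, ← hf i, Finset.sum_range]
    rfl
  rw [RingHom.map_det] at hv
  exact congrFun (Matrix.eq_zero_of_mulVec_eq_zero hv h) ⟨m, hm⟩

theorem differentiableAt_affineCoord (v : ℕ → ℝ) (n : ℕ) {x : ℝ}
    (hv : eval (Function.update v n x) (jacobiTrudi a).det ≠ 0) (q : ℕ × ℕ) :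
    DifferentiableAt ℝ (fun s => affineCoord a (Function.update v n s) q) x := by
  unfold affineCoord
  split_ifs with h
  · exact (hasDerivAt_eval_update _ v n x).differentiableAt.div
      (hasDerivAt_eval_update _ v n x).differentiableAt hv
  · exact differentiableAt_const _

theorem sum_shift_mul_affineCoord {v : ℕ → ℝ} (hv : eval v (jacobiTrudi a).det ≠ 0) (n k : ℕ)
    (i : Fin ℓ) :
    ∑ j ∈ Finset.range ℓ, eval v (elemSchurZ (a i + (j : ℤ) - n)) * affineCoord a v (k, j) =
      ∑ j ∈ Finset.range ℓ, eval v (elemSchurZ (a i + (j : ℤ))) *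
        (affineCoord a v (k, j + n) +
          ∑ p ∈ Finset.range n, affineCoord a v (n - p, j) * affineCoord a v (k, p)) := by
  rw [Finset.sum_subset (Finset.range_mono (Nat.le_add_left ℓ n)) fun j _ hj => by
    rw [affineCoord_of_le a v k (by simpa using hj), mul_zero], Finset.sum_range_add]
  simp_rw [mul_add]
  rw [Finset.sum_add_distrib, add_comm]
  congr 1
  · refine Finset.sum_congr rfl fun j _ => ?_
    rw [add_comm n j]
    congr 3
    push_cast
    ring
  · simp_rw [Finset.mul_sum]
    rw [Finset.sum_comm]
    refine Finset.sum_congr rfl fun p hp => ?_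
    rw [Finset.mem_range] at hp
    simp_rw [← mul_assoc]
    rw [← Finset.sum_mul, sum_mul_affineCoord a hv]
    congr 3
    omega

theorem hasDerivAt_affineCoord (v : ℕ → ℝ) {n : ℕ} (hn : 0 < n) {x : ℝ}
    (hv : eval (Function.update v n x) (jacobiTrudi a).det ≠ 0) (q : ℕ × ℕ) :
    HasDerivAt (fun s => affineCoord a (Function.update v n s) q)
      (eval (affineCoord a (Function.update v n x)) (riccati n (X q))) x := by
  obtain ⟨k, m⟩ := q
  have hdiff := fun q => (differentiableAt_affineCoord a v n hv q).hasDerivAt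
  refine (hdiff (k, m)).congr_deriv ?_
  set w := affineCoord a (Function.update v n x) with hw
  simp only [riccati_X, map_sub, map_sum, map_mul, eval_X]
  rcases le_or_gt ℓ m with hm | hm
  · simp only [hw, affineCoord_of_le a _ _ hm,
      affineCoord_of_le a _ _ (hm.trans (Nat.le_add_right m n))]
    simp
  rw [← sub_eq_zero]
  refine eq_zero_of_sum_mul_eq_zero a hv (f := fun m =>
    deriv (fun s => affineCoord a (Function.update v n s) (k, m)) x -
      (w (k + n, m) - w (k, m + n) - ∑ p ∈ Finset.range n, w (n - p, m) * w (k, p)))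
    (fun i => ?_) hm
  have hsum : HasDerivAt (fun s => ∑ j ∈ Finset.range ℓ,
      eval (Function.update v n s) (elemSchurZ (a i + (j : ℤ))) *
        affineCoord a (Function.update v n s) (k, j)) _ x :=
    HasDerivAt.fun_sum fun j _ =>
      (hasDerivAt_eval_update (elemSchurZ (a i + (j : ℤ))) v n x).mul (hdiff (k, j))
  have hrhs := hasDerivAt_eval_update (elemSchurZ (a i - (k : ℤ))) v n x
  have hev : ∀ᶠ s in nhds x, eval (Function.update v n s) (jacobiTrudi a).det ≠ 0 :=
    (hasDerivAt_eval_update _ v n x).continuousAt.eventually_ne hv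
  have heq := (hsum.congr_of_eventuallyEq
    (hev.mono fun s hs => (sum_mul_affineCoord a hs k i).symm)).unique hrhs
  simp only [pderiv_elemSchurZ n hn] at heq
  rw [Finset.sum_add_distrib, sum_shift_mul_affineCoord a hv] at heq
  have hkn := sum_mul_affineCoord a hv (k + n) i
  rw [Nat.cast_add, ← sub_sub, ← heq] at hkn
  simp only [mul_sub, mul_add, Finset.sum_sub_distrib, Finset.sum_add_distrib] at hkn ⊢
  rw [← hw] at hkn
  linarith

theorem pderiv_one_det_jacobiTrudi (v : ℕ → ℝ) (hv : eval v (jacobiTrudi a).det ≠ 0) :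
    eval v (pderiv 1 (jacobiTrudi a).det) =
      eval v (jacobiTrudi a).det * affineCoord a v (1, 0) := by
  rw [Derivation.map_det]
  have hcol : ∀ i j : Fin ℓ, pderiv 1 (jacobiTrudi a i j) = elemSchurZ (a i + (j : ℤ) - 1) :=
    fun i j => pderiv_elemSchurZ 1 one_pos _
  simp_rw [hcol]
  rcases Nat.eq_zero_or_pos ℓ with rfl | hℓ
  · simp [affineCoord]
  rw [Finset.sum_eq_single ⟨0, hℓ⟩, affineCoord, dif_pos hℓ, mul_div_cancel₀ _ hv,
    Matrix.cramer_apply]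
  · simp
  · intro j _ hj
    have hj0 : 0 < (j : ℕ) := Nat.pos_of_ne_zero fun h => hj (Fin.ext h)
    have hlt : (j : ℕ) - 1 < ℓ := by omega
    have hne : (⟨j - 1, hlt⟩ : Fin ℓ) ≠ j := fun h => by
      have := congrArg Fin.val h
      simp only at this
      omega
    refine Matrix.det_zero_of_column_eq hne fun i => ?_
    rw [Matrix.updateCol_self, Matrix.updateCol_ne hne]
    change elemSchurZ _ = _
    congr 1
    simp only
    omega
  · simp

theorem hasDerivAt_eval_affineCoord (v : ℕ → ℝ) {n : ℕ} (hn : 0 < n) {x : ℝ}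
    (hv : eval (Function.update v n x) (jacobiTrudi a).det ≠ 0) (P : MvPolynomial (ℕ × ℕ) ℝ) :
    HasDerivAt (fun s => eval (affineCoord a (Function.update v n s)) P)
      (eval (affineCoord a (Function.update v n x)) (riccati n P)) x := by
  induction P using MvPolynomial.induction_on with
  | C r => simpa [riccati] using hasDerivAt_const x r
  | add p q hp hq => simpa using hp.fun_add hq
  | mul_X p i hp =>
    simp only [map_mul, eval_X]
    refine (hp.fun_mul (hasDerivAt_affineCoord a v hn hv i)).congr_deriv ?_
    simp [Derivation.leibniz]
    ring

theorem hasDerivAt_log_det_jacobiTrudi (v : ℕ → ℝ) {x : ℝ}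
    (hv : eval (Function.update v 1 x) (jacobiTrudi a).det ≠ 0) :
    HasDerivAt (fun s => Real.log (eval (Function.update v 1 s) (jacobiTrudi a).det))
      (eval (affineCoord a (Function.update v 1 x)) (X (1, 0))) x := by
  convert (hasDerivAt_eval_update (jacobiTrudi a).det v 1 x).log hv using 1
  rw [pderiv_one_det_jacobiTrudi a _ hv, mul_div_cancel_left₀ _ hv, eval_X]

end affineCoord

theorem iteratedDeriv_eq_of_forall_hasDerivAt {α : Type*} {O : Set ℝ} (hO : IsOpen O)
    {F : α → ℝ → ℝ} {D : α → α} (hF : ∀ P, ∀ s ∈ O, HasDerivAt (F P) (F (D P) s) s) (n : ℕ) :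
    ∀ {f : ℝ → ℝ} {P : α}, (∀ s ∈ O, f s = F P s) →
      ∀ s ∈ O, iteratedDeriv n f s = F (D^[n] P) s := by
  induction n with
  | zero => exact fun hf s hs => by simpa using hf s hs
  | succ n ih =>
    intro f P hf s hs
    rw [iteratedDeriv_succ', Function.iterate_succ_apply]
    refine ih (fun r hr => ?_) s hs
    rw [Filter.EventuallyEq.deriv_eq (Filter.eventually_of_mem (hO.mem_nhds hr) hf)]
    exact (hF P r hr).deriv

/-- The KP equation for `u = 2 ∂_1 w_{1,0}`; here `w_{1,0}` is `∂_1 log τ`. -/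
theorem riccati_kp (U : MvPolynomial (ℕ × ℕ) ℝ) (hU : U = C 2 * riccati 1 (X (1, 0))) :
    C (3 / 4) * riccati 2 (riccati 2 U) =
      riccati 1 (riccati 3 U - C (3 / 2) * U * riccati 1 U
        - C (1 / 4) * riccati 1 (riccati 1 (riccati 1 U))) := by
  obtain ⟨c, hc⟩ : ∃ c : MvPolynomial (ℕ × ℕ) ℝ, c = C (1 / 4) := ⟨_, rfl⟩
  have hc4 : 4 * c = 1 := by
    rw [hc, show (4 : MvPolynomial (ℕ × ℕ) ℝ) = C 4 from rfl, ← C_mul]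
    norm_num
  have hdc : ∀ n, riccati n c = 0 := fun n => by rw [hc, derivation_C]
  have h34 : (C (3 / 4) : MvPolynomial (ℕ × ℕ) ℝ) = 3 * c := by
    rw [hc, show (3 : MvPolynomial (ℕ × ℕ) ℝ) = C 3 from rfl, ← C_mul]
    norm_num
  have h32 : (C (3 / 2) : MvPolynomial (ℕ × ℕ) ℝ) = 6 * c := by
    rw [hc, show (6 : MvPolynomial (ℕ × ℕ) ℝ) = C 6 from rfl, ← C_mul]
    norm_num
  have h2 : (C 2 : MvPolynomial (ℕ × ℕ) ℝ) = 2 := rfl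
  have hnum : ∀ n r : ℕ, [r.AtLeastTwo] → riccati n (OfNat.ofNat r) = 0 := fun n r _ =>
    Derivation.map_natCast _ _
  have hb := congrArg (fun P => riccati 1 (riccati 1 P)) riccati_bilinear
  rw [hU, h34, h32, ← hc, h2]
  simp only [map_add, map_sub, pow_two, Derivation.leibniz, smul_eq_mul, map_zero,
    hnum, hdc, ← riccati_comm_two, ← riccati_comm_three, riccati_two_X_one_zero] at hb ⊢
  simp only [mul_zero, zero_mul, add_zero] at hb ⊢
  linear_combination 2 * c * hb + 2 * riccati 1 (riccati 1 (riccati 3 (X (1, 0)))) * hc4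

/-- Let `τ(x,y,t)` be the Schur polynomial `S_λ` evaluated at
`x₁ = x, x₂ = y, x₃ = t, x_j = c_j (j ≥ 4)`.  Then `u = 2 ∂²_x log τ` satisfies the
Kadomtsev–Petviashvili equation
`(3/4) u_{yy} = ∂_x (u_t − (3/2) u u_x − (1/4) u_{xxx})`
wherever `τ ≠ 0`. -/
theorem schur_tau_solves_KP (ℓ : ℕ) (lam : Fin ℓ → ℕ) (hlam : Antitone lam)
    (c : ℕ → ℝ)
    (τ : ℝ → ℝ → ℝ → ℝ)
    (hτ : τ = fun x y t =>
      MvPolynomial.eval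
        (fun j => if j = 1 then x else if j = 2 then y else if j = 3 then t else c j)
        (schurOfPartition ℓ lam))
    (u : ℝ → ℝ → ℝ → ℝ)
    (hu : u = fun x y t => 2 * iteratedDeriv 2 (fun s => Real.log (τ s y t)) x) :
    ∀ x y t : ℝ, τ x y t ≠ 0 →
      (3 / 4) * iteratedDeriv 2 (fun s => u x s t) y
        = deriv (fun s =>
            deriv (fun r => u s y r) t
              - (3 / 2) * u s y t * deriv (fun r => u r y t) s
              - (1 / 4) * iteratedDeriv 3 (fun r => u r y t) s) x := by
  intro x y t hxyt
  set a : Fin ℓ → ℤ := fun i => (lam i : ℤ) - (i : ℤ) with ha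
  set pt : ℝ → ℝ → ℝ → ℕ → ℝ := fun x y t j =>
    if j = 1 then x else if j = 2 then y else if j = 3 then t else c j with hpt
  have hτ' : ∀ x y t, τ x y t = eval (pt x y t) (jacobiTrudi a).det := by
    intro x y t
    rw [hτ]
    rfl
  have hpt1 : ∀ x y t, Function.update (pt 0 y t) 1 x = pt x y t := by
    intro x y t
    ext j
    by_cases h : j = 1 <;> simp [hpt, h]
  have hpt2 : ∀ x y t, Function.update (pt x 0 t) 2 y = pt x y t := by
    intro x y t
    ext j
    by_cases h : j = 2 <;> simp [hpt, h]
  have hpt3 : ∀ x y t, Function.update (pt x y 0) 3 t = pt x y t := by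
    intro x y t
    ext j
    by_cases h : j = 3 <;> simp [hpt, h]
  set F : MvPolynomial (ℕ × ℕ) ℝ → ℝ → ℝ → ℝ → ℝ := fun P x y t =>
    eval (affineCoord a (pt x y t)) P with hF
  have hF1 : ∀ P x y t, τ x y t ≠ 0 →
      HasDerivAt (fun s => F P s y t) (F (riccati 1 P) x y t) x := by
    intro P x y t h
    rw [hτ', ← hpt1] at h
    simpa only [hpt1] using hasDerivAt_eval_affineCoord a _ one_pos h P
  have hF2 : ∀ P x y t, τ x y t ≠ 0 →
      HasDerivAt (fun s => F P x s t) (F (riccati 2 P) x y t) y := by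
    intro P x y t h
    rw [hτ', ← hpt2] at h
    simpa only [hpt2] using hasDerivAt_eval_affineCoord a _ two_pos h P
  have hF3 : ∀ P x y t, τ x y t ≠ 0 →
      HasDerivAt (fun s => F P x y s) (F (riccati 3 P) x y t) t := by
    intro P x y t h
    rw [hτ', ← hpt3] at h
    simpa only [hpt3] using hasDerivAt_eval_affineCoord a _ three_pos h P
  have hopen : ∀ (v : ℕ → ℝ) (n : ℕ),
      IsOpen {s : ℝ | eval (Function.update v n s) (jacobiTrudi a).det ≠ 0} := fun v n =>
    isOpen_ne_fun (continuous_iff_continuousAt.2 fun s =>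
      (hasDerivAt_eval_update _ v n s).continuousAt) continuous_const
  have hO1 : ∀ y t, IsOpen {s | τ s y t ≠ 0} := by
    intro y t
    simpa only [hτ', hpt1] using hopen (pt 0 y t) 1
  have hO2 : ∀ x t, IsOpen {s | τ x s t ≠ 0} := by
    intro x t
    simpa only [hτ', hpt2] using hopen (pt x 0 t) 2
  have hO3 : ∀ x y, IsOpen {s | τ x y s ≠ 0} := by
    intro x y
    simpa only [hτ', hpt3] using hopen (pt x y 0) 3
  have hlog : ∀ x y t, τ x y t ≠ 0 →
      deriv (fun s => Real.log (τ s y t)) x = F (X (1, 0)) x y t := by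
    intro x y t h
    rw [hτ', ← hpt1] at h
    simpa only [hτ', hpt1] using (hasDerivAt_log_det_jacobiTrudi a _ h).deriv
  obtain ⟨U, hU⟩ : ∃ U, U = C 2 * riccati 1 (X (1, 0)) := ⟨_, rfl⟩
  have huF : ∀ x y t, τ x y t ≠ 0 → u x y t = F U x y t := by
    intro x y t h
    rw [hu, hU]
    simp only [hF, map_mul, eval_C]
    rw [iteratedDeriv_succ', iteratedDeriv_one]
    congr 1
    rw [Filter.EventuallyEq.deriv_eq (Filter.eventually_of_mem ((hO1 y t).mem_nhds h)
      fun s hs => hlog s y t hs)]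
    exact (hF1 _ x y t h).deriv
  have hux : ∀ s, τ s y t ≠ 0 → deriv (fun r => u r y t) s = F (riccati 1 U) s y t := by
    intro s hs
    rw [Filter.EventuallyEq.deriv_eq (Filter.eventually_of_mem ((hO1 y t).mem_nhds hs)
      fun r hr => huF r y t hr)]
    exact (hF1 _ s y t hs).deriv
  have hut : ∀ s, τ s y t ≠ 0 → deriv (fun r => u s y r) t = F (riccati 3 U) s y t := by
    intro s hs
    rw [Filter.EventuallyEq.deriv_eq (Filter.eventually_of_mem ((hO3 s y).mem_nhds hs)
      fun r hr => huF s y r hr)]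
    exact (hF3 _ s y t hs).deriv
  have huxxx := iteratedDeriv_eq_of_forall_hasDerivAt (hO1 y t) (F := fun P s => F P s y t)
    (fun P s hs => hF1 P s y t hs) 3 (fun r hr => huF r y t hr)
  have huyy := iteratedDeriv_eq_of_forall_hasDerivAt (hO2 x t) (F := fun P s => F P x s t)
    (fun P s hs => hF2 P x s t hs) 2 (fun r hr => huF x r t hr) y hxyt
  have hrhs : ∀ s, τ s y t ≠ 0 →
      deriv (fun r => u s y r) t - (3 / 2) * u s y t * deriv (fun r => u r y t) s
        - (1 / 4) * iteratedDeriv 3 (fun r => u r y t) s =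
      F (riccati 3 U - C (3 / 2) * U * riccati 1 U
        - C (1 / 4) * riccati 1 (riccati 1 (riccati 1 U))) s y t := by
    intro s hs
    rw [hut s hs, hux s hs, huF s y t hs, huxxx s hs]
    simp [hF]
  rw [huyy, Filter.EventuallyEq.deriv_eq (Filter.eventually_of_mem ((hO1 y t).mem_nhds hxyt) hrhs),
    (hF1 _ x y t hxyt).deriv, ← riccati_kp U hU]
  simp [hF]
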